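/- Let D be a pseudo-distribution on {-1,1}^n of degree at least 2t and let S ⊆ [n] with |S| ≤ t. Then there exists a probability distribution μ on {-1,1}^S such that for all T ⊆ S, Ẽ_D[X_T] = E_μ[X_T]. -/

import Mathlib

/-- The point of the hypercube `{-1,1}` encoded by a boolean. -/
def pm (b : Bool) : ℝ := if b then 1 else -1

/-- Pseudo-expectation of `f` with respect to `D` on `{-1,1}^n`. -/
def PE {n : ℕ} (D f : (Fin n → Bool) → ℝ) : ℝ := ∑ x, D x * f x

/-- The monomial `X_T(x) = ∏_{i ∈ T} x_i` on `{-1,1}^n`. -/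
def XS {n : ℕ} (T : Finset (Fin n)) (x : Fin n → Bool) : ℝ := ∏ i ∈ T, pm (x i)

/-- `f : {-1,1}^n → ℝ` is a polynomial of degree at most `d`. -/
def DegLE {n : ℕ} (d : ℕ) (f : (Fin n → Bool) → ℝ) : Prop :=
  ∃ c : Finset (Fin n) → ℝ, (∀ T : Finset (Fin n), d < T.card → c T = 0) ∧
    ∀ x, f x = ∑ T : Finset (Fin n), c T * XS T x

theorem one_add_pm_mul_pm_div_two (a b : Bool) :
    (1 + pm a * pm b) / 2 = if b = a then 1 else 0 := by
  cases a <;> cases b <;> norm_num [pm]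

/-- The indicator of a subcube fixing the coordinates in `S` is a product of affine factors. -/
theorem prod_one_add_pm_mul_pm_div_two {n : ℕ} (S : Finset (Fin n)) (z x : Fin n → Bool) :
    ∏ i ∈ S, (1 + pm (z i) * pm (x i)) / 2 = if ∀ i ∈ S, x i = z i then 1 else 0 := by
  simp_rw [one_add_pm_mul_pm_div_two]
  exact Finset.prod_ite_zero.trans (by simp)

/-- The indicator of a subcube fixing the coordinates in `S` has degree at most `S.card`. -/
theorem degLE_indicator {n t : ℕ} {S : Finset (Fin n)} (hS : S.card ≤ t) (z : Fin n → Bool) :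
    DegLE t (fun x => if ∀ i ∈ S, x i = z i then 1 else 0) := by
  refine ⟨fun T => if T ∈ S.powerset then XS T z / 2 ^ S.card else 0, fun T hT => ?_, fun x => ?_⟩
  · refine if_neg fun h => ?_
    have := Finset.card_le_card (Finset.mem_powerset.1 h)
    omega
  · simp_rw [ite_mul, zero_mul]
    rw [← prod_one_add_pm_mul_pm_div_two, Finset.sum_ite_mem, Finset.univ_inter,
      Finset.prod_div_distrib, Finset.prod_one_add, Finset.prod_const, Finset.sum_div]
    refine Finset.sum_congr rfl fun T _ => ?_
    rw [Finset.prod_mul_distrib, XS, XS]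
    ring

/-- Pushing `D` forward along the restriction to `S` preserves pseudo-expectations. -/
theorem sum_PE_indicator_mul {n : ℕ} (D : (Fin n → Bool) → ℝ) (S : Finset (Fin n))
    (g : ({ i // i ∈ S } → Bool) → ℝ) :
    ∑ y, PE D (fun x => if (fun i : { i // i ∈ S } => x i) = y then 1 else 0) * g y =
      PE D (fun x => g (fun i => x i)) := by
  simp_rw [PE, Finset.sum_mul]
  rw [Finset.sum_comm]
  simp

/-- Local distributions: if `D` is a pseudo-distribution of degree
at least `2t` on `{-1,1}^n` and `S ⊆ [n]` has `|S| ≤ t`, then there is a genuine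
probability distribution `μ` on `{-1,1}^S` matching all moments `X_T`, `T ⊆ S`. -/
theorem local_distribution (n t : ℕ) (D : (Fin n → Bool) → ℝ)
    (hsum : ∑ x, D x = 1)
    (hdeg : ∀ f : (Fin n → Bool) → ℝ, DegLE t f → 0 ≤ PE D (fun x => f x * f x))
    (S : Finset (Fin n)) (hS : S.card ≤ t) :
    ∃ μ : ({ i // i ∈ S } → Bool) → ℝ, (∀ y, 0 ≤ μ y) ∧ (∑ y, μ y = 1) ∧
      ∀ T : Finset (Fin n), (hT : T ⊆ S) →
        PE D (XS T) = ∑ y, μ y * ∏ i ∈ T.attach, pm (y ⟨i.1, hT i.2⟩) := by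
  refine ⟨fun y => PE D (fun x => if (fun i : { i // i ∈ S } => x i) = y then 1 else 0),
    fun y => ?_, ?_, fun T hT => ?_⟩
  · let z : Fin n → Bool := fun i => if h : i ∈ S then y ⟨i, h⟩ else true
    have hz : ∀ x : Fin n → Bool, (∀ i ∈ S, x i = z i) ↔ (fun i : { i // i ∈ S } => x i) = y := by
      intro x
      rw [funext_iff, Subtype.forall]
      refine forall₂_congr fun i hi => ?_
      simp [z, hi]
    simpa [hz, ← ite_and] using hdeg _ (degLE_indicator hS z)
  · simpa [PE, hsum] using sum_PE_indicator_mul D S (fun _ => 1)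
  · rw [sum_PE_indicator_mul D S (fun y => ∏ i ∈ T.attach, pm (y ⟨i.1, hT i.2⟩))]
    refine congrArg (PE D) (funext fun x => ?_)
    exact (Finset.prod_attach T fun i => pm (x i)).symm
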